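/- For all integers m, n, t > 0 and all integers a, b ≥ 0 with a + b ≤ n−t, the number of m-divisible small (m,t)-Schröder paths S of height n with ret(S) = b and dg(S) = n−t−a−b satisfies n · #{S ∈ S(m,n,t) : S is m-divisible, ret(S) = b and dg(S) = n−t−a−b} = (t+b)·C(mn+a−1, a)·C(n, n−t−a−b), as an identity of integers. -/

import Mathlib

/-- A step of a lattice path: north `(0,1)`, east `(1,0)` or diagonal `(1,1)`. -/
inductive Step : Type
  | N : Step
  | E : Step
  | D : Step
  deriving DecidableEq

/-- The displacement vector of a step. -/
def stepVec : Step → ℤ × ℤ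
  | .N => (0, 1)
  | .E => (1, 0)
  | .D => (1, 1)

/-- The lattice point reached after the first `k` steps of the path `P` (starting at the
origin). -/
def pt (P : List Step) (k : ℕ) : ℤ × ℤ := ((P.take k).map stepVec).sum

/-- The path `P` starts with at least `t` north steps. -/
def StartsNorth (t : ℤ) (P : List Step) : Prop := List.replicate t.toNat Step.N <+: P

/-- The path `P` stays weakly above the line `x = m·y`. -/
def AboveLine (m : ℤ) (P : List Step) : Prop := ∀ k : ℕ, (pt P k).1 ≤ m * (pt P k).2

/-- An `(m,t)`-Schröder path of height `n`: a lattice path from `(0,0)` to `(mn,n)` using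
north, east and diagonal steps, starting with at least `t` north steps and never going
below the line `x = m·y`. -/
def IsSchroeder (m n t : ℤ) (P : List Step) : Prop :=
  StartsNorth t P ∧ pt P P.length = (m * n, n) ∧ AboveLine m P

/-- An `(m,t)`-Dyck path of height `n`: an `(m,t)`-Schröder path of height `n` with no
diagonal steps. -/
def IsDyck (m n t : ℤ) (P : List Step) : Prop :=
  IsSchroeder m n t P ∧ ∀ s ∈ P, s ≠ Step.D

/-- A Schröder path is small if none of its diagonal steps starts on the line `x = m·y`. -/
def IsSmall (m : ℤ) (P : List Step) : Prop :=
  ∀ j : ℕ, P[j]? = some Step.D → (pt P j).1 ≠ m * (pt P j).2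

/-- A Schröder path is positive if it touches the line `x = m·y` only at its two
endpoints. -/
def IsPositive (m : ℤ) (P : List Step) : Prop :=
  ∀ k : ℕ, 0 < k → k < P.length → (pt P k).1 ≠ m * (pt P k).2

/-- The set of indices `j` such that the `j`-th step of `P` is east and the `(j+1)`-st is
north; the corresponding valley point is `pt P (j+1)`. -/
def valleys (P : List Step) : Finset ℕ :=
  (Finset.range P.length).filter fun j => P[j]? = some Step.E ∧ P[j + 1]? = some Step.N

/-- The number of valleys of `P`. -/
def val (P : List Step) : ℕ := (valleys P).card

/-- The number of valleys of `P` whose `x`-coordinate is congruent to `i` modulo `m`. -/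
def ival (m i : ℤ) (P : List Step) : ℕ :=
  ((valleys P).filter fun j => (pt P (j + 1)).1 % m = i % m).card

/-- The set of returns of `P`: valleys of the form `(m·i, i)`. -/
def returns (m : ℤ) (P : List Step) : Finset ℕ :=
  (valleys P).filter fun j => (pt P (j + 1)).1 = m * (pt P (j + 1)).2

/-- The number of returns of `P`. -/
def ret (m : ℤ) (P : List Step) : ℕ := (returns m P).card

/-- The set of indices of diagonal steps of `P`. -/
def diags (P : List Step) : Finset ℕ :=
  (Finset.range P.length).filter fun j => P[j]? = some Step.D

/-- The number of diagonal steps of `P`. -/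
def dg (P : List Step) : ℕ := (diags P).card

/-- A Schröder path is `m`-divisible if every diagonal step ends at an `x`-coordinate
divisible by `m`. -/
def MDivisible (m : ℤ) (P : List Step) : Prop :=
  ∀ j ∈ diags P, m ∣ (pt P (j + 1)).1

/-- The number of cornered diagonal steps of `P`: diagonal steps connecting `(i·m − 1, i)`
to `(i·m, i + 1)` for some `i`. -/
def cd (m : ℤ) (P : List Step) : ℕ :=
  ((diags P).filter fun j => (pt P (j + 1)).1 = m * ((pt P (j + 1)).2 - 1)).card

/-- The generalized binomial coefficient `C(p,q) = p(p−1)⋯(p−q+1)/q!` for integers `p` and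
`q ≥ 0`, and `C(p,q) = 0` for `q < 0`. -/
def C (p q : ℤ) : ℤ :=
  if q < 0 then 0
  else if 0 ≤ p then (p.toNat.choose q.toNat : ℤ)
  else (-1) ^ q.toNat * ((q - p - 1).toNat.choose q.toNat : ℤ)

/-! ### Identities for the generalized binomial coefficient -/

theorem C_of_neg (p : ℤ) {q : ℤ} (hq : q < 0) : C p q = 0 := by
  simp [C, hq]

theorem C_natCast_natCast (p q : ℕ) : C p q = p.choose q := by
  simp [C]

theorem C_eq_ringChoose (p : ℤ) (q : ℕ) : C p q = Ring.choose p q := by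
  rcases le_or_gt 0 p with hp | hp
  · lift p to ℕ using hp
    rw [C_natCast_natCast, Ring.choose_natCast]
  · obtain ⟨r, rfl⟩ : ∃ r : ℕ, p = -(r + 1 : ℤ) := ⟨(-p - 1).toNat, by omega⟩
    rw [Ring.choose_neg]
    have h : (r + 1 + q - 1 : ℤ) = ((r + q : ℕ) : ℤ) := by push_cast; ring
    have h' : (q - (-(r + 1)) - 1 : ℤ) = ((r + q : ℕ) : ℤ) := by push_cast; ring
    rw [h, Ring.choose_natCast]
    unfold C
    rw [if_neg (by omega), if_neg (by omega), h']
    have h'' : (r + q : ℤ).toNat = r + q := by omega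
    simp [Int.negOnePow_def, Units.smul_def, h'']

theorem C_zero_right (p : ℤ) : C p 0 = 1 := by
  have := C_eq_ringChoose p 0
  simpa using this

theorem C_add_one_left (p q : ℤ) : C (p + 1) q = C p (q - 1) + C p q := by
  rcases lt_trichotomy q 0 with hq | rfl | hq
  · rw [C_of_neg _ hq, C_of_neg _ hq, C_of_neg _ (by omega), add_zero]
  · rw [C_zero_right, C_zero_right, C_of_neg _ (by omega), zero_add]
  · obtain ⟨k, rfl⟩ : ∃ k : ℕ, q = ((k + 1 : ℕ) : ℤ) := ⟨(q - 1).toNat, by omega⟩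
    rw [show ((k + 1 : ℕ) : ℤ) - 1 = k by push_cast; ring]
    simp only [C_eq_ringChoose, Ring.choose_succ_succ]

theorem sub_add_one_mul_C_sub_one (p : ℕ) (q : ℤ) :
    (p - q + 1) * C p (q - 1) = q * C p q := by
  rcases lt_trichotomy q 0 with hq | rfl | hq
  · rw [C_of_neg _ hq, C_of_neg _ (by omega), mul_zero, mul_zero]
  · rw [C_of_neg _ (by omega), mul_zero, zero_mul]
  · obtain ⟨k, rfl⟩ : ∃ k : ℕ, q = ((k + 1 : ℕ) : ℤ) := ⟨(q - 1).toNat, by omega⟩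
    rw [show ((k + 1 : ℕ) : ℤ) - 1 = k by push_cast; ring, C_natCast_natCast, C_natCast_natCast]
    rcases le_or_gt k p with h | h
    · have := Nat.choose_succ_right_eq p k
      zify [h] at this
      push_cast
      linarith
    · simp [Nat.choose_eq_zero_of_lt h, Nat.choose_eq_zero_of_lt (h.trans (Nat.lt_succ_self k))]

theorem add_one_mul_C (k : ℕ) (q : ℤ) : (k + 1) * C k q = (k + 1 - q) * C (k + 1) q := by
  rw [C_add_one_left]
  linarith [sub_add_one_mul_C_sub_one k q]

/-! ### The counting function -/

/-- The number of ways to complete a small `m`-divisible path that still has to go `X` steps to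
the right, where `d` diagonal steps remain and `a` is the number of remaining north steps, not
counting one north step for each remaining return. -/
def completionCount (m X a d : ℤ) : ℤ :=
  C ((X + m - 1) / m - 1) d * C (X + a - 1) a
    - m * (C ((X + m - 1) / m) d * C (X + a - 1) (a - 1))

theorem completionCount_of_neg (m X : ℤ) {a d : ℤ} (h : a < 0 ∨ d < 0) :
    completionCount m X a d = 0 := by
  rcases h with h | h
  · simp [completionCount, C_of_neg _ h, C_of_neg _ (show a - 1 < 0 by omega)]
  · simp [completionCount, C_of_neg _ h]

theorem completionCount_zero_zero (m X : ℤ) : completionCount m X 0 0 = 1 := by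
  simp [completionCount, C_zero_right, C_of_neg]

theorem completionCount_rec {m : ℤ} (hm : 0 < m) (X a d : ℤ) :
    completionCount m X a d = completionCount m X (a - 1) d + completionCount m (X - 1) a d +
      if m ∣ X - 1 then completionCount m (X - 1) a (d - 1) else 0 := by
  have h₁ := C_add_one_left (X + a - 2) a
  have h₂ := C_add_one_left (X + a - 2) (a - 1)
  rw [show X + a - 2 + 1 = X + a - 1 by ring] at h₁ h₂
  unfold completionCount
  rw [show X + (a - 1) - 1 = X + a - 2 by ring, show X - 1 + a - 1 = X + a - 2 by ring, h₁, h₂]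
  split_ifs with h
  · obtain ⟨k, hk⟩ := h
    obtain rfl : X = m * k + 1 := by omega
    have e₁ : (m * k + 1 + m - 1) / m = k + 1 := by
      rw [show m * k + 1 + m - 1 = m * (k + 1) by ring, Int.mul_ediv_cancel_left _ hm.ne']
    have e₂ : (m * k + 1 - 1 + m - 1) / m = k := by
      rw [show m * k + 1 - 1 + m - 1 = m - 1 + m * k by ring, Int.add_mul_ediv_left _ _ hm.ne',
        Int.ediv_eq_zero_of_lt (by omega) (by omega), zero_add]
    have p₁ := C_add_one_left k d
    have p₂ := C_add_one_left (k - 1) d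
    rw [sub_add_cancel] at p₂
    rw [e₁, e₂, p₁, add_sub_cancel_right, p₂]
    ring
  · have e : (X + m - 1) / m = (X - 1 + m - 1) / m := by
      obtain ⟨h₀, h₁⟩ : 0 ≤ (X - 1) % m ∧ (X - 1) % m < m :=
        ⟨Int.emod_nonneg _ hm.ne', Int.emod_lt_of_pos _ hm⟩
      have h₂ : (X - 1) % m ≠ 0 := fun h' => h (Int.dvd_of_emod_eq_zero h')
      have h₃ := Int.emod_add_mul_ediv (X - 1) m
      generalize (X - 1) % m = r at *
      generalize (X - 1) / m = k at *
      obtain rfl : X = r + m * k + 1 := by omega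
      rw [show r + m * k + 1 + m - 1 = r + m * (k + 1) by ring,
        show r + m * k + 1 - 1 + m - 1 = (r - 1) + m * (k + 1) by ring,
        Int.add_mul_ediv_left _ _ hm.ne', Int.add_mul_ediv_left _ _ hm.ne',
        Int.ediv_eq_zero_of_lt (by omega) (by omega), Int.ediv_eq_zero_of_lt (by omega) (by omega)]
    rw [e]
    ring

theorem mul_completionCount_mul {m k : ℤ} (hm : 0 < m) (hk : 0 < k) (a d : ℤ) :
    k * completionCount m (m * k) a d = (k - a - d) * C (m * k + a - 1) a * C k d := by
  rcases lt_or_ge a 0 with ha | ha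
  · rw [completionCount_of_neg _ _ (Or.inl ha), C_of_neg _ ha]
    ring
  have e : (m * k + m - 1) / m = k := by
    rw [show m * k + m - 1 = m - 1 + m * k by ring, Int.add_mul_ediv_left _ _ hm.ne',
      Int.ediv_eq_zero_of_lt (by omega) (by omega), zero_add]
  have h₁ := add_one_mul_C (k - 1).toNat d
  have hmk : 0 < m * k := mul_pos hm hk
  have h₂ := sub_add_one_mul_C_sub_one (m * k + a - 1).toNat a
  rw [Int.toNat_of_nonneg (by omega)] at h₁ h₂
  rw [sub_add_cancel] at h₁
  rw [completionCount, e]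
  linear_combination C (m * k + a - 1) a * h₁ - C k d * h₂

/-! ### Completions of a path -/

/-- `IsCompletion m X Y b d L` holds if `L` is the remaining part of a small `m`-divisible path
which still has to go `X` steps to the right and `Y` steps up, with `b` returns after an east step
of `L` and `d` diagonal steps in `L`. -/
def IsCompletion (m : ℤ) : ℤ → ℤ → ℤ → ℤ → List Step → Prop
  | X, Y, b, d, [] => X = 0 ∧ Y = 0 ∧ b = 0 ∧ d = 0
  | X, Y, b, d, .N :: L => m * Y ≤ X ∧ IsCompletion m X (Y - 1) b d L
  | X, Y, b, d, .E :: L =>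
      m * Y < X ∧ IsCompletion m (X - 1) Y (if X - 1 = m * Y ∧ 0 < Y then b - 1 else b) d L
  | X, Y, b, d, .D :: L => m * Y < X ∧ m ∣ X - 1 ∧ IsCompletion m (X - 1) (Y - 1) b (d - 1) L

theorem IsCompletion.nonneg {m X Y b d : ℤ} {L : List Step} (h : IsCompletion m X Y b d L) :
    0 ≤ Y ∧ 0 ≤ b := by
  induction L generalizing X Y b d with
  | nil => obtain ⟨-, rfl, rfl, -⟩ := h; simp
  | cons s L ih =>
    cases s with
    | N => have := ih h.2; omega
    | E =>
      have := ih h.2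
      split_ifs at this <;> omega
    | D => have := ih h.2.2; omega

/-- The set `S` is finite and has `z` elements. -/
def HasCard {α : Type*} (S : Set α) (z : ℤ) : Prop := S.Finite ∧ (S.ncard : ℤ) = z

theorem hasCard_empty {α : Type*} : HasCard (∅ : Set α) 0 := by simp [HasCard]

theorem hasCard_singleton {α : Type*} (x : α) : HasCard {x} 1 := by simp [HasCard]

theorem HasCard.image {α β : Type*} {S : Set α} {z : ℤ} (h : HasCard S z) {f : α → β}
    (hf : f.Injective) : HasCard (f '' S) z :=
  ⟨h.1.image f, by rw [Set.ncard_image_of_injective _ hf, h.2]⟩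

theorem HasCard.union {α : Type*} {S T : Set α} {y z : ℤ} (hS : HasCard S y) (hT : HasCard T z)
    (hd : Disjoint S T) : HasCard (S ∪ T) (y + z) :=
  ⟨hS.1.union hT.1, by rw [Set.ncard_union_eq hd hS.1 hT.1, Nat.cast_add, hS.2, hT.2]⟩

theorem disjoint_image_cons {s s' : Step} (h : s ≠ s') (S T : Set (List Step)) :
    Disjoint (List.cons s '' S) (List.cons s' '' T) := by
  rw [Set.disjoint_left]
  rintro _ ⟨L, -, rfl⟩ ⟨L', -, h'⟩
  exact h (List.cons.inj h').1.symm

theorem setOf_isCompletion_of_lt {m X Y : ℤ} (h : m * Y < X) (b d : ℤ) (hX : X ≠ 0) :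
    {L | IsCompletion m X Y b d L} =
      List.cons .N '' {L | IsCompletion m X (Y - 1) b d L} ∪
      List.cons .E '' {L | IsCompletion m (X - 1) Y
        (if X - 1 = m * Y ∧ 0 < Y then b - 1 else b) d L} ∪
      List.cons .D '' {L | m ∣ X - 1 ∧ IsCompletion m (X - 1) (Y - 1) b (d - 1) L} := by
  ext L
  rcases L with _ | ⟨_ | _ | _, L⟩ <;> simp [IsCompletion, hX, h, h.le]

theorem setOf_isCompletion_line {m Y : ℤ} (b d : ℤ) (hY : Y ≠ 0) :
    {L | IsCompletion m (m * Y) Y b d L} =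
      List.cons .N '' {L | IsCompletion m (m * Y) (Y - 1) b d L} := by
  ext L
  rcases L with _ | ⟨_ | _ | _, L⟩ <;> simp [IsCompletion, hY]

theorem setOf_isCompletion_zero {m : ℤ} (b d : ℤ) :
    {L | IsCompletion m 0 0 b d L} = {L | L = [] ∧ b = 0 ∧ d = 0} := by
  ext L
  rcases L with _ | ⟨_ | _ | _, L⟩ <;> simp [IsCompletion]
  intro h
  have := h.nonneg
  omega

theorem hasCard_isCompletion {m : ℤ} (hm : 0 < m) (k : ℕ) {X Y b d : ℤ} (hk : X + Y ≤ k)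
    (hXY : m * Y < X) (hb : 0 ≤ b) :
    HasCard {L | IsCompletion m X Y b d L} (completionCount m X (Y - b - d) d) := by
  induction k generalizing X Y b d with
  | zero =>
    have hY : Y < 0 := by
      by_contra! hY
      have := mul_nonneg hm.le hY
      push_cast at hk
      linarith
    rw [completionCount_of_neg _ _ (by omega)]
    convert hasCard_empty
    exact Set.eq_empty_of_forall_notMem fun L hL => by have := IsCompletion.nonneg hL; omega
  | succ k ih =>
    push_cast at hk
    rcases lt_or_ge Y 0 with hY | hY
    · rw [completionCount_of_neg _ _ (by omega)]
      convert hasCard_empty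
      exact Set.eq_empty_of_forall_notMem fun L hL => by have := IsCompletion.nonneg hL; omega
    have hmY : 0 ≤ m * Y := mul_nonneg hm.le hY
    have hN : HasCard {L | IsCompletion m X (Y - 1) b d L}
        (completionCount m X (Y - b - d - 1) d) := by
      rw [show Y - b - d - 1 = Y - 1 - b - d by ring]
      exact ih (by omega) (by linarith) hb
    have hD : HasCard {L | m ∣ X - 1 ∧ IsCompletion m (X - 1) (Y - 1) b (d - 1) L}
        (if m ∣ X - 1 then completionCount m (X - 1) (Y - b - d) (d - 1) else 0) := by
      split_ifs with hdvd
      · simp only [hdvd, true_and]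
        rw [show Y - b - d = Y - 1 - b - (d - 1) by ring]
        exact ih (by omega) (by linarith) hb
      · simpa [hdvd] using hasCard_empty
    have hE : HasCard {L | IsCompletion m (X - 1) Y
        (if X - 1 = m * Y ∧ 0 < Y then b - 1 else b) d L}
        (completionCount m (X - 1) (Y - b - d) d) := by
      rcases eq_or_ne (X - 1) (m * Y) with hX | hX
      · rcases hY.eq_or_lt with rfl | hY
        · rw [mul_zero] at hX
          simp only [hX, lt_irrefl, and_false, if_false, setOf_isCompletion_zero]
          by_cases hbd : b = 0 ∧ d = 0
          · obtain ⟨rfl, rfl⟩ := hbd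
            simpa [completionCount_zero_zero] using hasCard_singleton ([] : List Step)
          · rw [completionCount_of_neg _ _ (by omega)]
            simpa [hbd] using hasCard_empty
        · rw [if_pos ⟨hX, hY⟩, hX]
          rcases hb.eq_or_lt with rfl | hb
          · have h := mul_completionCount_mul hm hY (Y - 0 - d) d
            rw [show Y - (Y - 0 - d) - d = 0 by ring, zero_mul, zero_mul, mul_eq_zero] at h
            rw [h.resolve_left hY.ne']
            convert hasCard_empty
            exact Set.eq_empty_of_forall_notMem fun L hL => by
              have := IsCompletion.nonneg hL; omega
          · rw [setOf_isCompletion_line _ _ hY.ne',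
              show Y - b - d = Y - 1 - (b - 1) - d by ring]
            exact (ih (by omega) (by linarith) (by omega)).image List.cons_injective
      · rw [if_neg (by tauto)]
        exact ih (by omega) (by omega) hb
    rw [setOf_isCompletion_of_lt hXY b d (by omega), completionCount_rec hm]
    refine ((hN.image List.cons_injective).union (hE.image List.cons_injective)
      (disjoint_image_cons (by simp) _ _)).union (hD.image List.cons_injective) ?_
    rw [Set.disjoint_union_left]
    exact ⟨disjoint_image_cons (by simp) _ _, disjoint_image_cons (by simp) _ _⟩

/-! ### Paths as completions of the empty path -/

theorem pt_zero (L : List Step) : pt L 0 = 0 := by simp [pt]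

theorem pt_cons_succ (s : Step) (L : List Step) (k : ℕ) :
    pt (s :: L) (k + 1) = stepVec s + pt L k := by simp [pt]

theorem pt_snd_nonneg (L : List Step) (k : ℕ) : 0 ≤ (pt L k).2 := by
  induction L generalizing k with
  | nil => simp [pt]
  | cons s L ih =>
    cases k with
    | zero => simp [pt]
    | succ k =>
      rw [pt_cons_succ, Prod.snd_add]
      exact add_nonneg (by cases s <;> simp [stepVec]) (ih k)

/-- The number of valleys of `L` at points `(x, y)` with `x - m * y = h`. -/
def valleysAt (m h : ℤ) (L : List Step) : ℕ :=
  ((valleys L).filter fun j => (pt L (j + 1)).1 - m * (pt L (j + 1)).2 = h).card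

theorem valleysAt_cons (m h : ℤ) (s : Step) (L : List Step) :
    valleysAt m h (s :: L) =
      valleysAt m (h - ((stepVec s).1 - m * (stepVec s).2)) L +
        if s = .E ∧ L[0]? = some .N ∧ (stepVec s).1 - m * (stepVec s).2 = h then 1 else 0 := by
  simp only [valleysAt, valleys, Finset.filter_filter, Finset.card_filter, List.length_cons,
    Finset.sum_range_succ', pt_cons_succ, pt_zero, List.getElem?_cons_succ, List.getElem?_cons_zero,
    Option.some.injEq, Prod.fst_add, Prod.snd_add, Prod.fst_zero,
    Prod.snd_zero, add_zero, and_assoc]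
  congr 1
  refine Finset.sum_congr rfl fun j _ => ?_
  congr 3
  exact propext ⟨fun h => by linarith, fun h => by linarith⟩

theorem dg_cons (s : Step) (L : List Step) : dg (s :: L) = dg L + if s = .D then 1 else 0 := by
  simp only [dg, diags, Finset.card_filter, List.length_cons, Finset.sum_range_succ',
    List.getElem?_cons_succ, List.getElem?_cons_zero, Option.some.injEq]

theorem ret_eq_valleysAt (m : ℤ) (P : List Step) : ret m P = valleysAt m 0 P := by
  simp only [ret, returns, valleysAt, sub_eq_zero]

theorem isCompletion_iff {m X Y b d : ℤ} {L : List Step} :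
    IsCompletion m X Y b d L ↔
      pt L L.length = (X, Y) ∧ (∀ k, (pt L k).1 - m * (pt L k).2 ≤ X - m * Y) ∧
      (∀ j, L[j]? = some .D → (pt L j).1 - m * (pt L j).2 ≠ X - m * Y) ∧
      (∀ j, L[j]? = some .D → m ∣ X - (pt L (j + 1)).1) ∧
      (valleysAt m (X - m * Y) L : ℤ) = b ∧ (dg L : ℤ) = d := by
  induction L generalizing X Y b d with
  | nil =>
    simp only [IsCompletion, pt, valleysAt, valleys, dg, diags]
    simp only [List.take_nil, List.map_nil, List.sum_nil, Prod.ext_iff]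
    simp
    constructor
    · rintro ⟨rfl, rfl, rfl, rfl⟩; simp
    · rintro ⟨⟨rfl, rfl⟩, -, rfl, rfl⟩; simp
  | cons s L ih =>
    have hpt : pt (s :: L) (s :: L).length = (X, Y) ↔
        pt L L.length = (X - (stepVec s).1, Y - (stepVec s).2) := by
      rw [List.length_cons, pt_cons_succ, Prod.ext_iff, Prod.ext_iff]
      constructor <;> rintro ⟨h, h'⟩ <;> constructor <;> simp_all <;> linarith
    have habove : (∀ k, (pt (s :: L) k).1 - m * (pt (s :: L) k).2 ≤ X - m * Y) ↔
        0 ≤ X - m * Y ∧ ∀ k, (pt L k).1 - m * (pt L k).2 ≤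
          (X - (stepVec s).1) - m * (Y - (stepVec s).2) := by
      rw [← Nat.and_forall_add_one]
      simp only [pt_zero, pt_cons_succ, Prod.fst_add, Prod.snd_add]
      refine and_congr (by simp) (forall_congr' fun k => ?_)
      constructor <;> intro h <;> linarith
    have hsmall : (∀ j, (s :: L)[j]? = some .D →
          (pt (s :: L) j).1 - m * (pt (s :: L) j).2 ≠ X - m * Y) ↔
        (s = .D → X - m * Y ≠ 0) ∧ ∀ j, L[j]? = some .D → (pt L j).1 - m * (pt L j).2 ≠
          (X - (stepVec s).1) - m * (Y - (stepVec s).2) := by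
      rw [← Nat.and_forall_add_one]
      simp only [pt_zero, pt_cons_succ, Prod.fst_add, Prod.snd_add, List.getElem?_cons_succ,
        List.getElem?_cons_zero, Option.some.injEq]
      refine and_congr (by simp [eq_comm]) (forall_congr' fun k => imp_congr_right fun _ => ?_)
      refine not_congr ?_
      constructor <;> intro h <;> linarith
    have hdiv : (∀ j, (s :: L)[j]? = some .D → m ∣ X - (pt (s :: L) (j + 1)).1) ↔
        (s = .D → m ∣ X - 1) ∧ ∀ j, L[j]? = some .D →
          m ∣ (X - (stepVec s).1) - (pt L (j + 1)).1 := by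
      rw [← Nat.and_forall_add_one]
      simp only [pt_zero, pt_cons_succ, Prod.fst_add, List.getElem?_cons_succ,
        List.getElem?_cons_zero, Option.some.injEq, sub_add_eq_sub_sub]
      refine and_congr_left fun _ => forall_congr' ?_
      rintro rfl
      simp [stepVec]
    rw [hpt, habove, hsmall, hdiv, valleysAt_cons, dg_cons]
    have hh : X - m * Y - ((stepVec s).1 - m * (stepVec s).2) =
      X - (stepVec s).1 - m * (Y - (stepVec s).2) := by ring
    rw [hh]
    cases s with
    | N =>
      simp only [IsCompletion, ih, stepVec]
      simp
      tauto
    | E =>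
      have hret : pt L L.length = (X - 1, Y) →
          (∀ k, (pt L k).1 - m * (pt L k).2 ≤ X - 1 - m * Y) →
          (∀ j, L[j]? = some .D → (pt L j).1 - m * (pt L j).2 ≠ X - 1 - m * Y) →
          (X - 1 = m * Y ∧ 0 < Y ↔ L[0]? = some .N ∧ 1 = X - m * Y) := by
        intro h₁ h₂ h₃
        rw [show 1 = X - m * Y ↔ X - 1 = m * Y from ⟨fun h => by linarith, fun h => by linarith⟩,
          and_comm]
        refine and_congr_left fun h => ?_
        rcases L with _ | ⟨_ | _ | _, L⟩
        · simp_all [pt, Prod.ext_iff]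
        · rw [List.length_cons, pt_cons_succ, Prod.ext_iff] at h₁
          have := pt_snd_nonneg L L.length
          have := h₁.2
          simp [stepVec] at this
          simp
          omega
        · have := h₂ 1
          simp [pt, stepVec] at this
          omega
        · exact absurd (by simp [pt, h]) (h₃ 0 rfl)
      simp only [IsCompletion, ih, stepVec]
      simp only [true_and, reduceCtorEq, false_imp_iff, if_false, add_zero, mul_zero, sub_zero]
      constructor
      · rintro ⟨h₀, h₁, h₂, h₃, h₄, h₅, h₆⟩
        refine ⟨h₁, ⟨by omega, h₂⟩, h₃, h₄, ?_, h₆⟩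
        simp only [hret h₁ h₂ h₃] at h₅
        split_ifs at h₅ ⊢ <;> push_cast <;> omega
      · rintro ⟨h₁, ⟨h₀, h₂⟩, h₃, h₄, h₅, h₆⟩
        have := h₂ 0
        rw [pt_zero, Prod.fst_zero, Prod.snd_zero] at this
        refine ⟨by omega, h₁, h₂, h₃, h₄, ?_, h₆⟩
        simp only [hret h₁ h₂ h₃]
        split_ifs at h₅ ⊢ <;> push_cast at h₅ <;> omega
    | D =>
      simp only [IsCompletion, ih, stepVec]
      simp only [true_imp_iff, reduceCtorEq, false_and, if_false, if_true, add_zero,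
        Nat.cast_add, Nat.cast_one, eq_sub_iff_add_eq,
        show m * Y < X ↔ 0 ≤ X - m * Y ∧ X - m * Y ≠ 0 by omega]
      exact ⟨fun ⟨⟨h₀, h₀'⟩, hd, h₁, h₂, h₃, h₄, h₅⟩ => ⟨h₁, ⟨h₀, h₂⟩, ⟨h₀', h₃⟩, ⟨hd, h₄⟩, h₅⟩,
        fun ⟨h₁, ⟨h₀, h₂⟩, ⟨h₀', h₃⟩, ⟨hd, h₄⟩, h₅⟩ => ⟨⟨h₀, h₀'⟩, hd, h₁, h₂, h₃, h₄, h₅⟩⟩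

theorem isCompletion_replicate_append {m n b d : ℤ} (hm : 0 < m) (t : ℕ) (L : List Step) :
    IsCompletion m (m * n) n b d (List.replicate t .N ++ L) ↔
      IsCompletion m (m * n) (n - t) b d L := by
  suffices ∀ Y ≤ n, IsCompletion m (m * n) Y b d (List.replicate t .N ++ L) ↔
      IsCompletion m (m * n) (Y - t) b d L from this n le_rfl
  induction t with
  | zero => simp
  | succ t ih =>
    intro Y hY
    rw [List.replicate_succ, List.cons_append, IsCompletion, ih _ (by omega)]
    push_cast
    rw [show Y - 1 - (t : ℤ) = Y - (t + 1) by ring]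
    exact and_iff_right (by gcongr)

theorem isSchroeder_and_iff {m n t b d : ℤ} {S : List Step} :
    (IsSchroeder m n t S ∧ IsSmall m S ∧ MDivisible m S ∧ (ret m S : ℤ) = b ∧ (dg S : ℤ) = d) ↔
      StartsNorth t S ∧ IsCompletion m (m * n) n b d S := by
  have hdiv : MDivisible m S ↔ ∀ j, S[j]? = some .D → m ∣ m * n - (pt S (j + 1)).1 := by
    unfold MDivisible diags
    refine forall_congr' fun j => ?_
    rw [Finset.mem_filter, Finset.mem_range, dvd_sub_right (Dvd.intro _ rfl)]
    refine ⟨fun h h' => h ⟨(List.getElem?_eq_some_iff.1 h').1, h'⟩, fun h h' => h h'.2⟩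
  rw [isCompletion_iff, hdiv, ret_eq_valleysAt]
  simp only [IsSchroeder, AboveLine, IsSmall, sub_self, sub_nonpos, sub_ne_zero, and_assoc]

/-- the number of `m`-divisible small `(m,t)`-Schröder paths of height `n`
with `b` returns and `n−t−a−b` diagonal steps. -/
theorem statement5 (m n t a b : ℤ) (hm : 0 < m) (hn : 0 < n) (ht : 0 < t)
    (ha : 0 ≤ a) (hb : 0 ≤ b) (hab : a + b ≤ n - t) :
    n * (({S : List Step | IsSchroeder m n t S ∧ IsSmall m S ∧ MDivisible m S ∧
        (ret m S : ℤ) = b ∧ (dg S : ℤ) = n - t - a - b}.ncard : ℤ))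
      = (t + b) * C (m * n + a - 1) a * C n (n - t - a - b) := by
  have hset : {S : List Step | IsSchroeder m n t S ∧ IsSmall m S ∧ MDivisible m S ∧
      (ret m S : ℤ) = b ∧ (dg S : ℤ) = n - t - a - b} =
      (List.replicate t.toNat Step.N ++ ·) ''
        {L | IsCompletion m (m * n) (n - t) b (n - t - a - b) L} := by
    ext S
    rw [Set.mem_ofPred_eq, isSchroeder_and_iff]
    constructor
    · rintro ⟨⟨L, rfl⟩, h⟩
      rw [isCompletion_replicate_append hm, Int.toNat_of_nonneg ht.le] at h
      exact ⟨L, h, rfl⟩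
    · rintro ⟨L, h, rfl⟩
      refine ⟨⟨L, rfl⟩, ?_⟩
      rw [isCompletion_replicate_append hm, Int.toNat_of_nonneg ht.le]
      exact h
  have hcard := (hasCard_isCompletion hm (m * n + (n - t)).toNat (d := n - t - a - b)
    (Int.self_le_toNat _) (show m * (n - t) < m * n by gcongr; omega) hb).image
    (List.append_right_injective (List.replicate t.toNat Step.N))
  rw [hset, hcard.2, mul_completionCount_mul hm hn]
  rw [show n - t - b - (n - t - a - b) = a by ring]
  ring
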